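/- The representation of the nilHecke algebra NHₙ on R[x₁,…,xₙ], where xᵢ acts by multiplication and ∂ᵢ acts by the i-th divided difference operator, is faithful when R is a field of characteristic zero (or R = ℤ). -/

import Mathlib

open MvPolynomial
open scoped Classical

/-- The divided difference operator `∂_{i,j} f = (f − σ_{ij} f)/(x_i − x_j)`, defined as the
(unique, since `X i − X j` is a regular element) quotient of `f − σ_{ij} f` by `X i − X j`. -/
noncomputable def divDiff {σ : Type*} [DecidableEq σ] {R : Type*} [CommRing R]
    (i j : σ) (f : MvPolynomial σ R) : MvPolynomial σ R :=
  if h : ∃ g, g * (X i - X j) = f - rename (Equiv.swap i j) f then h.choose else 0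

/-- Generators of the nilHecke algebra `NHₙ` on `n+1` variables: `Sum.inl i` is the dot
generator `xᵢ` (`i : Fin (n+1)`) and `Sum.inr k` is the divided difference generator `∂ₖ`
(`k : Fin n`). -/
abbrev NHGen (n : ℕ) := Fin (n + 1) ⊕ Fin n

/-- Abbreviations for the generators inside the free algebra. -/
noncomputable def xg (n : ℕ) (i : Fin (n + 1)) : FreeAlgebra ℤ (NHGen n) :=
  FreeAlgebra.ι ℤ (Sum.inl i)

noncomputable def dg (n : ℕ) (k : Fin n) : FreeAlgebra ℤ (NHGen n) :=
  FreeAlgebra.ι ℤ (Sum.inr k)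

/-- The defining relations of the nilHecke algebra `NHₙ`. -/
inductive NHRel (n : ℕ) : FreeAlgebra ℤ (NHGen n) → FreeAlgebra ℤ (NHGen n) → Prop
  | xcomm (i j : Fin (n + 1)) : NHRel n (xg n i * xg n j) (xg n j * xg n i)
  | dsq (k : Fin n) : NHRel n (dg n k * dg n k) 0
  | braid (k l : Fin n) (h : (l : ℕ) = (k : ℕ) + 1) :
      NHRel n (dg n k * dg n l * dg n k) (dg n l * dg n k * dg n l)
  | distant (k l : Fin n) (h : (k : ℕ) + 1 < (l : ℕ)) :
      NHRel n (dg n k * dg n l) (dg n l * dg n k)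
  | xd (k : Fin n) : NHRel n (xg n k.castSucc * dg n k) (dg n k * xg n k.succ + 1)
  | dx (k : Fin n) : NHRel n (dg n k * xg n k.castSucc) (xg n k.succ * dg n k + 1)
  | far (k : Fin n) (i : Fin (n + 1)) (h1 : i ≠ k.castSucc) (h2 : i ≠ k.succ) :
      NHRel n (xg n i * dg n k) (dg n k * xg n i)

/-- The nilHecke algebra `NHₙ`, presented by generators and relations. -/
abbrev NH (n : ℕ) := RingQuot (NHRel n)

/-- The word `d m * d (m+1) * ... * d (m+len-1)`. -/
def nhU {M : Type*} [MonoidWithZero M] (d : ℕ → M) : ℕ → ℕ → M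
  | _, 0 => 1
  | m, len + 1 => d m * nhU d (m + 1) len

section words
variable {M : Type*} [MonoidWithZero M] (d : ℕ → M)

theorem nhU_comm (hfar : ∀ k l, k + 1 < l → d k * d l = d l * d k) (j : ℕ) :
    ∀ len m, j + 1 < m → d j * nhU d m len = nhU d m len * d j := by
  intro len
  induction len with
  | zero => intro m _; simp [nhU]
  | succ len ih =>
    intro m h
    simp only [nhU]
    rw [← mul_assoc, hfar j m h, mul_assoc, ih (m + 1) (by omega), mul_assoc]

theorem nhU_shift (hfar : ∀ k l, k + 1 < l → d k * d l = d l * d k)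
    (hbraid : ∀ k, d k * d (k + 1) * d k = d (k + 1) * d k * d (k + 1)) (j : ℕ) :
    ∀ len m, m ≤ j → j + 1 < m + len → d (j + 1) * nhU d m len = nhU d m len * d j := by
  intro len
  induction len with
  | zero => intro m h h2; omega
  | succ len ih =>
    intro m h h2
    simp only [nhU]
    rcases Nat.lt_or_eq_of_le h with h | h
    · rw [← mul_assoc, ← hfar m (j + 1) (by omega), mul_assoc, ih (m + 1) (by omega) (by omega),
        mul_assoc]
    · subst h
      obtain ⟨l, rfl⟩ : ∃ l, len = l + 1 := ⟨len - 1, by omega⟩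
      simp only [nhU]
      rw [mul_assoc (d m), mul_assoc (d (m+1)), ← nhU_comm d hfar m l (m + 1 + 1) (by omega)]
      simp only [← mul_assoc]
      rw [hbraid]

theorem nh_words (hsq : ∀ k, d k * d k = 0)
    (hfar : ∀ k l, k + 1 < l → d k * d l = d l * d k)
    (hbraid : ∀ k, d k * d (k + 1) * d k = d (k + 1) * d k * d (k + 1)) (k : ℕ) :
    ∃ B : Finset M, B.card ≤ (k + 1).factorial ∧ (1 : M) ∈ B ∧
      ∀ j < k, ∀ b ∈ B, d j * b = 0 ∨ d j * b ∈ B := by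
  induction k with
  | zero => exact ⟨{1}, by simp, by simp, by intro j hj; omega⟩
  | succ k ih =>
    obtain ⟨B, hc, h1, hB⟩ := ih
    let F : ℕ × M → M := fun p => nhU d (k + 1 - p.1) p.1 * p.2
    have mem : ∀ t b, t ≤ k + 1 → b ∈ B → nhU d (k + 1 - t) t * b ∈
        (Finset.range (k + 2) ×ˢ B).image F := by
      intro t b ht hb
      exact Finset.mem_image.2 ⟨(t, b), by simp [hb]; omega, rfl⟩
    refine ⟨(Finset.range (k + 2) ×ˢ B).image F, ?_, ?_, ?_⟩
    · refine Finset.card_image_le.trans ?_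
      rw [Finset.card_product, Finset.card_range, Nat.factorial_succ]
      exact Nat.mul_le_mul_left _ hc
    · simpa [nhU] using mem 0 1 (by omega) h1
    · intro j hj b hb
      obtain ⟨⟨t, b⟩, hp, rfl⟩ := Finset.mem_image.1 hb
      simp only [Finset.mem_product, Finset.mem_range] at hp
      obtain ⟨ht, hb'⟩ := hp
      simp only [F]
      obtain ⟨m, hm⟩ : ∃ m, m = k + 1 - t := ⟨_, rfl⟩
      have main : ∀ i < k, d j * nhU d (k + 1 - t) t = nhU d (k + 1 - t) t * d i →
          (d j * (nhU d (k + 1 - t) t * b) = 0 ∨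
           d j * (nhU d (k + 1 - t) t * b) ∈ (Finset.range (k + 2) ×ˢ B).image F) := by
        intro i hi he
        rw [← mul_assoc, he, mul_assoc]
        rcases hB i hi b hb' with h | h
        · left; rw [h, mul_zero]
        · right; exact mem t _ (by omega) h
      rcases Nat.lt_trichotomy (j + 1) (k + 1 - t) with h | h | h
      · exact main j (by omega) (nhU_comm d hfar j t _ h)
      · right
        have := mem (t + 1) b (by omega) hb'
        have e : k + 1 - (t + 1) = j := by omega
        rw [e] at this
        simp only [nhU] at this
        rw [← h, ← mul_assoc]
        exact this
      · rcases Nat.lt_or_ge (k + 1 - t) j with h' | h'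
        · obtain ⟨i, rfl⟩ : ∃ i, j = i + 1 := ⟨j - 1, by omega⟩
          exact main i (by omega) (nhU_shift d hfar hbraid i t _ (by omega) (by omega))
        · left
          have e : k + 1 - t = j := by omega
          obtain ⟨l, rfl⟩ : ∃ l, t = l + 1 := ⟨t - 1, by omega⟩
          rw [e]
          simp only [nhU]
          simp only [← mul_assoc, hsq, zero_mul]

end words

theorem divDiff_mul {σ : Type*} [DecidableEq σ] {R : Type*} [CommRing R]
    (i j : σ) (f : MvPolynomial σ R) :
    divDiff i j f * (X i - X j) = f - rename (Equiv.swap i j) f := by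
  have h : ∃ g, g * (X i - X j) = f - rename (Equiv.swap i j) f := by
    induction f using MvPolynomial.induction_on with
    | C a => exact ⟨0, by simp⟩
    | add p q hp hq =>
      obtain ⟨g, hg⟩ := hp
      obtain ⟨g', hg'⟩ := hq
      exact ⟨g + g', by rw [add_mul, hg, hg', map_add]; ring⟩
    | mul_X p l hp =>
      obtain ⟨g, hg⟩ := hp
      rw [map_mul, rename_X]
      obtain ⟨c, hc⟩ : ∃ c : MvPolynomial σ R, X l - X (Equiv.swap i j l) = c * (X i - X j) := by
        by_cases h1 : l = i
        · subst h1; exact ⟨1, by simp⟩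
        by_cases h2 : l = j
        · subst h2; exact ⟨-1, by simp⟩
        · exact ⟨0, by simp [Equiv.swap_apply_of_ne_of_ne h1 h2]⟩
      refine ⟨g * X l + rename (Equiv.swap i j) p * c, ?_⟩
      linear_combination X l * hg - rename (Equiv.swap i j) p * hc
  unfold divDiff
  rw [dif_pos h]
  exact h.choose_spec

theorem exists_poly_hom {A : Type*} [Ring A] {m : ℕ} (x : Fin m → A)
    (hc : ∀ i j, x i * x j = x j * x i) :
    ∃ ι : MvPolynomial (Fin m) ℤ →ₐ[ℤ] A, ∀ i, ι (X i) = x i := by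
  let _ : CommRing (Algebra.adjoin ℤ (Set.range x)) :=
    Algebra.adjoinCommRingOfComm ℤ (by
      rintro _ ⟨i, rfl⟩ _ ⟨j, rfl⟩; exact hc i j)
  let y : Fin m → Algebra.adjoin ℤ (Set.range x) := fun i =>
    ⟨x i, Algebra.subset_adjoin ⟨i, rfl⟩⟩
  refine ⟨((Algebra.adjoin ℤ (Set.range x)).val.toRingHom.comp
    (MvPolynomial.eval₂Hom (Int.castRingHom _) y)).toIntAlgHom, fun i => ?_⟩
  change (Algebra.adjoin ℤ (Set.range x)).val
    (MvPolynomial.eval₂Hom (Int.castRingHom _) y (X i)) = x i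
  simp [y]

/-- Every element of the algebra is a combination of few words. -/
theorem nh_span (n : ℕ) (ι : MvPolynomial (Fin (n + 1)) ℤ →ₐ[ℤ] NH n)
    (hι : ∀ i, ι (X i) = RingQuot.mkAlgHom ℤ (NHRel n) (xg n i)) :
    ∃ B : Finset (NH n), B.card ≤ (n + 1).factorial ∧
      ∀ a : NH n, ∃ p : NH n → MvPolynomial (Fin (n + 1)) ℤ, a = ∑ b ∈ B, ι (p b) * b := by
  set π := RingQuot.mkAlgHom ℤ (NHRel n) with hπ
  have rel : ∀ {a b}, NHRel n a b → π a = π b := fun h => RingQuot.mkAlgHom_rel ℤ h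
  let d : ℕ → NH n := fun k => if h : k < n then π (dg n ⟨k, h⟩) else 0
  have hdk : ∀ k : Fin n, d k = π (dg n k) := fun k => by simp [d]
  have hd0 : ∀ k, ¬ k < n → d k = 0 := fun k h => by simp [d, h]
  obtain ⟨B, hc, h1, hB⟩ := nh_words d
    (by
      intro k
      by_cases h : k < n
      · have := rel (NHRel.dsq (n := n) ⟨k, h⟩)
        simpa [← hdk] using this
      · simp [hd0 k h])
    (by
      intro k l hkl
      by_cases h : l < n
      · have := rel (NHRel.distant (n := n) ⟨k, by omega⟩ ⟨l, h⟩ hkl)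
        simpa [← hdk] using this
      · simp [hd0 l h])
    (by
      intro k
      by_cases h : k + 1 < n
      · have := rel (NHRel.braid (n := n) ⟨k, by omega⟩ ⟨k + 1, h⟩ rfl)
        simpa [← hdk] using this
      · simp [hd0 (k + 1) h]) n
  refine ⟨B, hc, ?_⟩
  let L : AddSubmonoid (NH n) :=
    { carrier := {a | ∃ p : NH n → MvPolynomial (Fin (n + 1)) ℤ, a = ∑ b ∈ B, ι (p b) * b}
      zero_mem' := ⟨0, by simp⟩
      add_mem' := by
        rintro _ _ ⟨p, rfl⟩ ⟨q, rfl⟩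
        exact ⟨p + q, by simp [add_mul, Finset.sum_add_distrib]⟩ }
  have Lb : ∀ p, ∀ b ∈ B, ι p * b ∈ L := by
    intro p b hb
    refine ⟨fun c => if c = b then p else 0, ?_⟩
    rw [Finset.sum_eq_single b]
    · simp
    · intro c _ hcb; simp [hcb]
    · intro h; exact absurd hb h
  have Lx : ∀ p, ∀ a ∈ L, ι p * a ∈ L := by
    rintro p _ ⟨q, rfl⟩
    exact ⟨fun b => p * q b, by simp [Finset.mul_sum, mul_assoc]⟩
  have comm : ∀ (k : Fin n) (p : MvPolynomial (Fin (n + 1)) ℤ),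
      ∃ q r, d k * ι p = ι q * d k + ι r := by
    intro k p
    induction p using MvPolynomial.induction_on with
    | C a =>
      refine ⟨C a, 0, ?_⟩
      have : (C a : MvPolynomial (Fin (n + 1)) ℤ) = ((a : ℤ) : MvPolynomial (Fin (n + 1)) ℤ) := by
        simp
      rw [this, map_intCast, map_zero, add_zero]
      exact (Int.cast_commute a (d k)).symm.eq
    | add p p' hp hp' =>
      obtain ⟨q, r, h⟩ := hp
      obtain ⟨q', r', h'⟩ := hp'
      exact ⟨q + q', r + r', by simp only [map_add, mul_add, add_mul, h, h']; abel⟩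
    | mul_X p i hp =>
      obtain ⟨q, r, h⟩ := hp
      have : ∃ q' r', d k * ι (X i) = ι q' * d k + ι r' := by
        rw [hdk, hι]
        by_cases h1 : i = k.castSucc
        · subst h1
          refine ⟨X k.succ, 1, ?_⟩
          rw [hι]
          simpa using rel (NHRel.dx k)
        by_cases h2 : i = k.succ
        · subst h2
          refine ⟨X k.castSucc, -1, ?_⟩
          rw [hι]
          have := rel (NHRel.xd k)
          simp only [map_mul, map_add, map_one] at this
          rw [this]; simp
        · refine ⟨X i, 0, ?_⟩
          rw [hι]
          have := rel (NHRel.far k i h1 h2)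
          simp only [map_mul] at this
          rw [this]; simp
      obtain ⟨q', r', h'⟩ := this
      refine ⟨q * q', q * r' + r * X i, ?_⟩
      rw [map_mul, ← mul_assoc, h, add_mul, mul_assoc, h']
      simp only [map_mul, map_add, mul_add, mul_assoc, add_assoc]
  have Ld : ∀ k : Fin n, ∀ a ∈ L, d k * a ∈ L := by
    rintro k _ ⟨p, rfl⟩
    rw [Finset.mul_sum]
    refine L.sum_mem fun b hb => ?_
    obtain ⟨q, r, h⟩ := comm k (p b)
    rw [← mul_assoc, h, add_mul, mul_assoc]
    refine L.add_mem ?_ (Lb _ _ hb)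
    rcases hB k k.2 b hb with h | h
    · rw [h, mul_zero]; exact L.zero_mem
    · exact Lb _ _ h
  have all : ∀ w : FreeAlgebra ℤ (NHGen n), ∀ a ∈ L, π w * a ∈ L := by
    intro w
    induction w using FreeAlgebra.induction with
    | grade0 r =>
      intro a ha
      have := Lx (algebraMap _ _ r) a ha
      rwa [AlgHom.commutes] at this ⊢
    | grade1 g =>
      rcases g with i | k
      · intro a ha
        have := Lx (X i) a ha
        rwa [hι] at this
      · intro a ha
        have := Ld k a ha
        rwa [hdk] at this
    | mul u v hu hv =>
      intro a ha
      rw [map_mul, mul_assoc]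
      exact hu _ (hv _ ha)
    | add u v hu hv =>
      intro a ha
      rw [map_add, add_mul]
      exact L.add_mem (hu _ ha) (hv _ ha)
  intro a
  obtain ⟨w, rfl⟩ := RingQuot.mkAlgHom_surjective ℤ (NHRel n) a
  have h1L : (1 : NH n) ∈ L := by simpa using Lb 1 1 h1
  have := all w 1 h1L
  rwa [mul_one] at this

/-- the representation of the nilHecke algebra on the polynomial ring, where
`xᵢ` acts by multiplication and `∂ₖ` acts by the `k`-th divided difference operator, is
faithful (over `ℤ`): any `ℤ`-algebra map from `NHₙ` to endomorphisms of the polynomial ring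
sending the generators to these operators is injective. -/
theorem stmt_15 (n : ℕ) (φ : NH n →ₐ[ℤ] Module.End ℤ (MvPolynomial (Fin (n + 1)) ℤ))
    (hx : ∀ (i : Fin (n + 1)) (f : MvPolynomial (Fin (n + 1)) ℤ),
      φ (RingQuot.mkAlgHom ℤ (NHRel n) (xg n i)) f = X i * f)
    (hd : ∀ (k : Fin n) (f : MvPolynomial (Fin (n + 1)) ℤ),
      φ (RingQuot.mkAlgHom ℤ (NHRel n) (dg n k)) f = divDiff k.castSucc k.succ f) :
    Function.Injective φ := by
  set π := RingQuot.mkAlgHom ℤ (NHRel n) with hπ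
  obtain ⟨ι, hι⟩ : ∃ ι : MvPolynomial (Fin (n + 1)) ℤ →ₐ[ℤ] NH n,
      ∀ i, ι (X i) = π (xg n i) := exists_poly_hom (fun i => π (xg n i)) (by
    intro i j
    have := RingQuot.mkAlgHom_rel ℤ (NHRel.xcomm (n := n) i j)
    simpa using this)
  obtain ⟨B, hcard, hspan⟩ := nh_span n ι hι
  have hφι : ∀ p f, φ (ι p) f = p * f := by
    intro p
    induction p using MvPolynomial.induction_on with
    | C a =>
      intro f
      have : (C a : MvPolynomial (Fin (n + 1)) ℤ) = ((a : ℤ) : MvPolynomial (Fin (n + 1)) ℤ) := by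
        simp
      rw [this, map_intCast, map_intCast]
      simp
    | add p q hp hq => intro f; simp [hp, hq, add_mul]
    | mul_X p i hp =>
      intro f
      rw [map_mul, map_mul, Module.End.mul_apply, hι, hx, hp, mul_assoc]
  let P := MvPolynomial (Fin (n + 1)) ℤ
  let K := FractionRing P
  let ψ : NH n → (P → K) := fun a f => algebraMap P K (φ a f)
  have hψ : ∀ p : NH n → P, ψ (∑ b ∈ B, ι (p b) * b) = ∑ b ∈ B, algebraMap P K (p b) • ψ b := by
    intro p
    funext f
    simp only [ψ, Finset.sum_apply, Pi.smul_apply, smul_eq_mul]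
    rw [map_sum, LinearMap.sum_apply, map_sum]
    refine Finset.sum_congr rfl fun b _ => ?_
    rw [map_mul, Module.End.mul_apply, hφι]
    exact map_mul _ _ _
  -- permutations are in the image
  have hperm : ∀ s : Equiv.Perm (Fin (n + 1)), ∃ a, ∀ f, φ a f = rename s f := by
    intro s
    have hs : s ∈ Submonoid.closure
        (Set.range fun i : Fin n => Equiv.swap i.castSucc i.succ) := by
      rw [Equiv.Perm.mclosure_swap_castSucc_succ]; trivial
    induction hs using Submonoid.closure_induction with
    | mem s hs =>
      obtain ⟨k, rfl⟩ := hs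
      refine ⟨1 - ι (X k.castSucc - X k.succ) * π (dg n k), fun f => ?_⟩
      have := divDiff_mul k.castSucc k.succ f
      rw [map_sub, map_one, map_mul, LinearMap.sub_apply, Module.End.mul_apply, hφι, hd,
        Module.End.one_apply, mul_comm]
      convert sub_eq_of_eq_add' (sub_eq_iff_eq_add.1 this.symm)
    | one => exact ⟨1, fun f => by simp⟩
    | mul s t _ _ hs ht =>
      obtain ⟨a, ha⟩ := hs
      obtain ⟨b, hb⟩ := ht
      refine ⟨a * b, fun f => ?_⟩
      rw [map_mul, Module.End.mul_apply, hb, ha, rename_rename]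
      rfl
  let v : B → (P → K) := fun b => ψ b
  let g : Equiv.Perm (Fin (n + 1)) → (P →* K) := fun s =>
    ((algebraMap P K).comp (rename s : P →ₐ[ℤ] P).toRingHom : P →+* K)
  have hg : Function.Injective g := by
    intro s t h
    ext i
    have h1 := DFunLike.congr_fun h (X i)
    have h2 : algebraMap P K (rename s (X i)) = algebraMap P K (rename t (X i)) := h1
    have h3 := IsFractionRing.injective P K h2
    rw [rename_X, rename_X] at h3
    rw [X_injective h3]
  have hLI : LinearIndependent K (fun s => (g s : P → K)) :=
    (linearIndependent_monoidHom P K).comp g hg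
  have hmem : ∀ s, (g s : P → K) ∈ Submodule.span K (Set.range v) := by
    intro s
    obtain ⟨a, ha⟩ := hperm s
    obtain ⟨p, rfl⟩ := hspan a
    have : (g s : P → K) = ψ (∑ b ∈ B, ι (p b) * b) := by
      funext f
      exact (congrArg (algebraMap P K) (ha f)).symm
    rw [this, hψ]
    refine Submodule.sum_mem _ fun b hb => Submodule.smul_mem _ _ ?_
    exact Submodule.subset_span ⟨⟨b, hb⟩, rfl⟩
  have hv : LinearIndependent K v := by
    rw [linearIndependent_iff_card_le_finrank_span]
    have : FiniteDimensional K (Submodule.span K (Set.range v)) :=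
      FiniteDimensional.span_of_finite K (Set.finite_range v)
    have h1 : LinearIndependent K (fun s => (⟨g s, hmem s⟩ : Submodule.span K (Set.range v))) :=
      LinearIndependent.of_comp (Submodule.subtype _) hLI
    have h2 := h1.fintype_card_le_finrank
    rw [Fintype.card_perm, Fintype.card_fin] at h2
    refine le_trans ?_ h2
    simpa using hcard
  rw [injective_iff_map_eq_zero]
  intro a ha
  obtain ⟨p, rfl⟩ := hspan a
  have h0 : ∑ b ∈ B, algebraMap P K (p b) • ψ b = 0 := by
    rw [← hψ]
    funext f
    have h := congrArg (algebraMap P K) (LinearMap.congr_fun ha f)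
    exact h.trans (map_zero (algebraMap P K))
  rw [← Finset.sum_coe_sort] at h0
  have h1 := Fintype.linearIndependent_iff.1 hv (fun b => algebraMap P K (p b)) h0
  refine Finset.sum_eq_zero fun b hb => ?_
  have h2 := h1 ⟨b, hb⟩
  have h3 : p b = 0 := (map_eq_zero_iff _ (IsFractionRing.injective P K)).1 h2
  rw [h3, map_zero, zero_mul]
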